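/- Let n ≥ 3, let F be an odd-cycle-agreeing family of subgraphs of K_n, let e ∈ E_n, and let C_e(F) be the e-monotonization of F. Suppose there exist a triangle T and a subset S ⊆ T such that C_e(F) = {G ⊆ E_n : G ∩ T = S} (i.e. C_e(F) is a T-junta). Then F is also a T-junta: there exists S′ ⊆ T with F = {G ⊆ E_n : G ∩ T = S′}. -/

import Mathlib

/-- The edge set of the complete graph `K_n` on vertex set `Fin n`:
all non-diagonal unordered pairs. -/
def edgeFinset (n : ℕ) : Finset (Sym2 (Fin n)) :=
  Finset.univ.filter (fun e => ¬ e.IsDiag)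

/-- `T` is a triangle: the three edges on three distinct vertices. -/
def IsTriangle {n : ℕ} (T : Finset (Sym2 (Fin n))) : Prop :=
  ∃ a b c : Fin n, a ≠ b ∧ a ≠ c ∧ b ≠ c ∧ T = {s(a, b), s(a, c), s(b, c)}

/-- The simple graph on `Fin n` with edge set `G`. -/
def graphOf {n : ℕ} (G : Finset (Sym2 (Fin n))) : SimpleGraph (Fin n) :=
  SimpleGraph.fromEdgeSet (G : Set (Sym2 (Fin n)))

/-- The graph `G` contains a cycle of odd length. -/
def HasOddCycle {n : ℕ} (G : Finset (Sym2 (Fin n))) : Prop :=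
  ∃ (v : Fin n) (w : (graphOf G).Walk v v), w.IsCycle ∧ Odd w.length

/-- A family of graphs is odd-cycle-agreeing if for any two members `G, H`,
the complement (within `E_n`) of the symmetric difference `G Δ H` contains an
odd cycle. -/
def OddCycleAgreeing (n : ℕ) (F : Finset (Finset (Sym2 (Fin n)))) : Prop :=
  ∀ G ∈ F, ∀ H ∈ F, HasOddCycle (edgeFinset n \ ((G \ H) ∪ (H \ G)))

/-- The `e`-monotonization of a family `F`: each `G ∈ F` with `e ∉ G` and
`G ∪ {e} ∉ F` is replaced by `G ∪ {e}`. -/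
def monotonize {n : ℕ} (e : Sym2 (Fin n))
    (F : Finset (Finset (Sym2 (Fin n)))) : Finset (Finset (Sym2 (Fin n))) :=
  F.filter (fun G => e ∈ G ∨ insert e G ∈ F) ∪
    (F.filter (fun G => e ∉ G ∧ insert e G ∉ F)).image (insert e)

theorem mem_monotonize_of_mem {n : ℕ} {e : Sym2 (Fin n)}
    {F : Finset (Finset (Sym2 (Fin n)))} {G : Finset (Sym2 (Fin n))} (he : e ∈ G) :
    G ∈ monotonize e F ↔ G ∈ F ∨ G.erase e ∈ F := by
  simp only [monotonize, Finset.mem_union, Finset.mem_filter, Finset.mem_image]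
  constructor
  · rintro (h | ⟨H, ⟨hH, heH, -⟩, rfl⟩)
    · exact Or.inl h.1
    · right
      rwa [Finset.erase_insert heH]
  · intro h
    by_cases hG : G ∈ F
    · exact Or.inl ⟨hG, Or.inl he⟩
    · refine Or.inr ⟨G.erase e, ⟨h.resolve_left hG, Finset.notMem_erase e G, ?_⟩,
        Finset.insert_erase he⟩
      rwa [Finset.insert_erase he]

theorem mem_monotonize_of_notMem {n : ℕ} {e : Sym2 (Fin n)}
    {F : Finset (Finset (Sym2 (Fin n)))} {G : Finset (Sym2 (Fin n))} (he : e ∉ G) :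
    G ∈ monotonize e F ↔ G ∈ F ∧ insert e G ∈ F := by
  simp only [monotonize, Finset.mem_union, Finset.mem_filter, Finset.mem_image]
  constructor
  · rintro (h | ⟨H, -, rfl⟩)
    · exact ⟨h.1, h.2.resolve_left he⟩
    · exact absurd (Finset.mem_insert_self e H) he
  · exact fun h => Or.inl ⟨h.1, Or.inr h.2⟩

theorem mem_or_insert_mem_monotonize {n : ℕ} (e : Sym2 (Fin n))
    {F : Finset (Finset (Sym2 (Fin n)))} {G : Finset (Sym2 (Fin n))} (hG : G ∈ F) :
    G ∈ monotonize e F ∨ insert e G ∈ monotonize e F := by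
  by_cases he : e ∈ G
  · exact Or.inl ((mem_monotonize_of_mem he).2 (Or.inl hG))
  · right
    rw [mem_monotonize_of_mem (Finset.mem_insert_self e G), Finset.erase_insert he]
    exact Or.inr hG

theorem IsTriangle.exists_opposite {n : ℕ} {T : Finset (Sym2 (Fin n))} (hT : IsTriangle T)
    {e : Sym2 (Fin n)} (he : e ∈ T) :
    ∃ a b c : Fin n, a ≠ b ∧ a ≠ c ∧ b ≠ c ∧ e = s(b, c) ∧
      T = {s(a, b), s(a, c), s(b, c)} := by
  obtain ⟨a, b, c, hab, hac, hbc, rfl⟩ := hT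
  simp only [Finset.mem_insert, Finset.mem_singleton] at he
  rcases he with rfl | rfl | rfl
  · refine ⟨c, a, b, hac.symm, hbc.symm, hab, rfl, ?_⟩
    rw [Sym2.eq_swap (a := c) (b := a), Sym2.eq_swap (a := c) (b := b)]
    ext x; simp only [Finset.mem_insert, Finset.mem_singleton]; tauto
  · refine ⟨b, a, c, hab.symm, hbc, hac, rfl, ?_⟩
    rw [Sym2.eq_swap (a := b) (b := a)]
    ext x; simp only [Finset.mem_insert, Finset.mem_singleton]; tauto
  · exact ⟨a, b, c, hab, hac, hbc, rfl, rfl⟩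

theorem not_hasOddCycle_of_coloring {n : ℕ} {G : Finset (Sym2 (Fin n))} (f : Fin n → Bool)
    (hf : ∀ u v, u ≠ v → s(u, v) ∈ G → f u ≠ f v) : ¬ HasOddCycle G := by
  rintro ⟨v, w, -, hodd⟩
  let c : (graphOf G).Coloring Bool := SimpleGraph.Coloring.mk f (by
    intro u v huv
    rw [graphOf, SimpleGraph.fromEdgeSet_adj] at huv
    exact hf u v huv.2 (by simpa using huv.1))
  exact Nat.not_even_iff_odd.2 hodd ((c.even_length_iff_congr w).2 Iff.rfl)

/-- Two edges of a triangle together with an edge other than the third one span no odd cycle. -/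
theorem not_hasOddCycle_of_subset {n : ℕ} {a b c : Fin n} (hab : a ≠ b) (hac : a ≠ c)
    {d : Sym2 (Fin n)} (hd : d ≠ s(b, c)) {G : Finset (Sym2 (Fin n))}
    (hG : G ⊆ {s(a, b), s(a, c), d}) : ¬ HasOddCycle G := by
  have key : ∃ z, z ≠ b ∧ z ≠ c ∧ ∀ u v, u ≠ v → s(u, v) = d →
      decide (u = a ∨ u = z) ≠ decide (v = a ∨ v = z) := by
    induction d using Sym2.ind with
    | _ x y =>
    by_cases hxa : x = a
    · exact ⟨a, hab, hac, by grind⟩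
    by_cases hya : y = a
    · exact ⟨a, hab, hac, by grind⟩
    by_cases hx : x ≠ b ∧ x ≠ c
    · exact ⟨x, hx.1, hx.2, by grind⟩
    by_cases hy : y ≠ b ∧ y ≠ c
    · exact ⟨y, hy.1, hy.2, by grind⟩
    · refine ⟨a, hab, hac, ?_⟩
      grind
  obtain ⟨z, hzb, hzc, hz⟩ := key
  refine not_hasOddCycle_of_coloring (fun v => decide (v = a ∨ v = z)) fun u v huv h => ?_
  have h' := hG h
  simp only [Finset.mem_insert, Finset.mem_singleton] at h'
  rcases h' with h' | h' | h'
  · grind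
  · grind
  · exact hz u v huv h'

theorem eq_filter_of_monotonize_of_notMem {n : ℕ} {F : Finset (Finset (Sym2 (Fin n)))}
    (hF : F ⊆ (edgeFinset n).powerset) {e : Sym2 (Fin n)} {T S : Finset (Sym2 (Fin n))}
    (heT : e ∉ T)
    (hmono : monotonize e F = (edgeFinset n).powerset.filter (fun G => G ∩ T = S)) :
    F = (edgeFinset n).powerset.filter (fun G => G ∩ T = S) := by
  ext G
  constructor
  · intro hG
    rw [Finset.mem_filter]
    refine ⟨hF hG, ?_⟩
    have h := mem_or_insert_mem_monotonize e hG
    rw [hmono, Finset.mem_filter, Finset.mem_filter, Finset.insert_inter_of_notMem heT] at h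
    exact h.elim And.right And.right
  · intro hG
    by_cases heG : e ∈ G
    · have h : G.erase e ∈ monotonize e F := by
        rw [hmono, Finset.mem_filter, Finset.mem_powerset] at *
        refine ⟨(Finset.erase_subset e G).trans hG.1, ?_⟩
        rw [Finset.erase_inter, Finset.erase_eq_of_notMem (by simp [heT]), hG.2]
      rw [mem_monotonize_of_notMem (Finset.notMem_erase e G), Finset.insert_erase heG] at h
      exact h.2
    · rw [← hmono, mem_monotonize_of_notMem heG] at hG
      exact hG.1

theorem mem_of_monotonize_eq_filter {n : ℕ} {F : Finset (Finset (Sym2 (Fin n)))}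
    {e : Sym2 (Fin n)} {T S : Finset (Sym2 (Fin n))}
    (hTE : T ⊆ edgeFinset n) (hS : S ⊆ T) (heT : e ∈ T)
    (hmono : monotonize e F = (edgeFinset n).powerset.filter (fun G => G ∩ T = S)) :
    e ∈ S := by
  by_contra heS
  have hSm : S ∈ monotonize e F := by
    rw [hmono, Finset.mem_filter, Finset.mem_powerset]
    exact ⟨hS.trans hTE, Finset.inter_eq_left.2 hS⟩
  have h : insert e S ∈ monotonize e F := (mem_monotonize_of_mem (by simp)).2
    (Or.inl ((mem_monotonize_of_notMem heS).1 hSm).2)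
  rw [hmono, Finset.mem_filter] at h
  apply heS
  rw [← h.2]
  simp [heT]

/-- If members of `F` that differ on `e` cannot differ on almost all edges outside `T`, then
whether `S ∪ X` belongs to `F` does not depend on `X`. -/
theorem union_mem_iff_of_agreeing {n : ℕ} {F : Finset (Finset (Sym2 (Fin n)))}
    (hAgr : OddCycleAgreeing n F) {a b c : Fin n} (hab : a ≠ b) (hac : a ≠ c)
    {T S : Finset (Sym2 (Fin n))} (hT : T = {s(a, b), s(a, c), s(b, c)})
    (hTE : T ⊆ edgeFinset n) (hS : S ⊆ T) (heS : s(b, c) ∈ S)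
    (hmono : monotonize s(b, c) F = (edgeFinset n).powerset.filter (fun G => G ∩ T = S))
    {X : Finset (Sym2 (Fin n))} (hX : X ⊆ edgeFinset n \ T) :
    S ∪ X ∈ F ↔ S ∈ F := by
  have heT : s(b, c) ∈ T := hS heS
  have step : ∀ (d : Sym2 (Fin n)) (Y Z : Finset (Sym2 (Fin n))), d ≠ s(b, c) →
      Z ⊆ edgeFinset n \ T → (∀ x ∈ edgeFinset n \ T, x ≠ d → (x ∈ Y ↔ x ∉ Z)) →
      S ∪ Y ∈ F → S ∪ Z ∈ F := by
    intro d Y Z hd hZ hYZ hYF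
    have heZ : s(b, c) ∉ Z := fun h => (Finset.mem_sdiff.1 (hZ h)).2 heT
    have hZm : S ∪ Z ∈ monotonize s(b, c) F := by
      rw [hmono, Finset.mem_filter, Finset.mem_powerset]
      refine ⟨Finset.union_subset (hS.trans hTE) (hZ.trans Finset.sdiff_subset), ?_⟩
      ext x
      have := @hS x
      have := @hZ x
      simp only [Finset.mem_inter, Finset.mem_union, Finset.mem_sdiff] at *
      tauto
    rw [mem_monotonize_of_mem (Finset.mem_union_left _ heS)] at hZm
    refine hZm.resolve_right fun hZF => ?_
    refine not_hasOddCycle_of_subset hab hac hd ?_ (hAgr _ hYF _ hZF)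
    intro x hx
    by_cases hxT : x ∈ T
    · rw [hT] at hxT
      simp only [Finset.mem_insert, Finset.mem_singleton] at hxT ⊢
      rcases hxT with h | h | rfl
      · exact Or.inl h
      · exact Or.inr (Or.inl h)
      · simp [heS] at hx
    · have hxS : x ∉ S := fun h => hxT (hS h)
      have hxe : x ≠ s(b, c) := by rintro rfl; exact hxT heT
      by_cases hxd : x = d
      · simp [hxd]
      · simp only [Finset.mem_sdiff, Finset.mem_union, Finset.mem_erase] at hx
        have := hYZ x (Finset.mem_sdiff.2 ⟨hx.1, hxT⟩) hxd
        tauto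
  induction X using Finset.induction_on with
  | empty => simp
  | insert d X hdX ih =>
    rw [Finset.insert_subset_iff] at hX
    have hd : d ≠ s(b, c) := by rintro rfl; exact (Finset.mem_sdiff.1 hX.1).2 heT
    refine Iff.trans ?_ (ih hX.2)
    constructor
    · intro h
      refine step d _ X hd hX.2 ?_ (step d _ ((edgeFinset n \ T) \ X) hd Finset.sdiff_subset ?_ h)
      · intro x hx _
        simp [Finset.mem_sdiff.1 hx]
      · intro x hx hxd
        simp [Finset.mem_sdiff.1 hx, hxd]
    · intro h
      refine step d _ (insert d X) hd (Finset.insert_subset hX.1 hX.2) ?_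
        (step d _ ((edgeFinset n \ T) \ X) hd Finset.sdiff_subset ?_ h)
      · intro x hx hxd
        simp [Finset.mem_sdiff.1 hx, hxd]
      · intro x hx _
        simp [Finset.mem_sdiff.1 hx]

theorem IsTriangle.subset_edgeFinset {n : ℕ} {T : Finset (Sym2 (Fin n))} (hT : IsTriangle T) :
    T ⊆ edgeFinset n := by
  obtain ⟨a, b, c, hab, hac, hbc, rfl⟩ := hT
  simp [Finset.insert_subset_iff, edgeFinset, hab, hac, hbc]

theorem monotonize_junta
    (n : ℕ) (hn : 3 ≤ n)
    (F : Finset (Finset (Sym2 (Fin n))))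
    (hF : F ⊆ (edgeFinset n).powerset)
    (hAgr : OddCycleAgreeing n F)
    (e : Sym2 (Fin n)) (he : e ∈ edgeFinset n)
    (T S : Finset (Sym2 (Fin n))) (hT : IsTriangle T) (hS : S ⊆ T)
    (hmono : monotonize e F =
      (edgeFinset n).powerset.filter (fun G => G ∩ T = S)) :
    ∃ S' : Finset (Sym2 (Fin n)), S' ⊆ T ∧
      F = (edgeFinset n).powerset.filter (fun G => G ∩ T = S') := by
  have hTE := hT.subset_edgeFinset
  by_cases heT : e ∈ T
  swap
  · exact ⟨S, hS, eq_filter_of_monotonize_of_notMem hF heT hmono⟩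
  have heS := mem_of_monotonize_eq_filter hTE hS heT hmono
  have hjunta : ∀ G ⊆ edgeFinset n, G ∩ T = S → (G ∈ F ↔ S ∈ F) := by
    intro G hG hGS
    obtain ⟨a, b, c, hab, hac, -, rfl, hTeq⟩ := hT.exists_opposite heT
    rw [← union_mem_iff_of_agreeing hAgr hab hac hTeq hTE hS heS hmono
      (Finset.sdiff_subset_sdiff hG Finset.Subset.rfl), ← hGS, Finset.union_comm,
      Finset.sdiff_union_inter]
  have hmem : ∀ {G}, G ∈ monotonize e F ↔ G ⊆ edgeFinset n ∧ G ∩ T = S := by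
    intro G
    rw [hmono, Finset.mem_filter, Finset.mem_powerset]
  have heG : ∀ {G : Finset (Sym2 (Fin n))}, G ∩ T = S → e ∈ G := fun h =>
    (Finset.mem_inter.1 (h ▸ heS)).1
  by_cases hSF : S ∈ F
  · refine ⟨S, hS, ?_⟩
    ext G
    rw [Finset.mem_filter, Finset.mem_powerset]
    refine ⟨fun hG => hmem.1 ?_, fun hG => (hjunta G hG.1 hG.2).2 hSF⟩
    rcases mem_or_insert_mem_monotonize e hG with h | h
    · exact h
    · by_cases heG' : e ∈ G
      · rwa [Finset.insert_eq_of_mem heG'] at h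
      · exact (mem_monotonize_of_notMem heG').2
          ⟨hG, (hjunta _ (hmem.1 h).1 (hmem.1 h).2).2 hSF⟩
  · refine ⟨S.erase e, (Finset.erase_subset e S).trans hS, ?_⟩
    ext G
    rw [Finset.mem_filter, Finset.mem_powerset]
    constructor
    · intro hG
      have hGm : G ∉ monotonize e F := fun h =>
        hSF ((hjunta G (hmem.1 h).1 (hmem.1 h).2).1 hG)
      have hi := (mem_or_insert_mem_monotonize e hG).resolve_left hGm
      have heG' : e ∉ G := fun h => hGm (by rwa [Finset.insert_eq_of_mem h] at hi)
      refine ⟨Finset.mem_powerset.1 (hF hG), ?_⟩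
      rw [← (hmem.1 hi).2, Finset.insert_inter_of_mem heT, Finset.erase_insert]
      exact fun h => heG' (Finset.mem_inter.1 h).1
    · rintro ⟨hGE, hGT⟩
      have heG' : e ∉ G := fun h =>
        Finset.notMem_erase e S (hGT ▸ Finset.mem_inter.2 ⟨h, heT⟩)
      have hi : insert e G ⊆ edgeFinset n ∧ insert e G ∩ T = S :=
        ⟨Finset.insert_subset he hGE, by
          rw [Finset.insert_inter_of_mem heT, hGT, Finset.insert_erase heS]⟩
      have h := (mem_monotonize_of_mem (Finset.mem_insert_self e G)).1 (hmem.2 hi)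
      rw [Finset.erase_insert heG'] at h
      exact h.resolve_left fun h' => hSF ((hjunta _ hi.1 hi.2).1 h')
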